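/- In the group G with presentation <α, β : α^p = β^q = (α^{p/2}β)^2 = 1> (p ≥ 4 even, q ≥ 3 odd), an element of the form α^{a}β^{b} with 0 < a < p, 0 < b < q has finite order only if a = p/2, in which case it has order 2. -/

import Mathlib

/-- The relators `α^p`, `β^q`, `(α^{p/2}β)^2` on two generators (`true ↦ α`, `false ↦ β`). -/
def presRels (p q : ℕ) : Set (FreeGroup Bool) :=
  {FreeGroup.of true ^ p, FreeGroup.of false ^ q,
    (FreeGroup.of true ^ (p / 2) * FreeGroup.of false) ^ 2}

open Monoid in
/-- In an amalgamated product, the product of two letters outside the amalgamated subgroup and from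
different factors has infinite order. -/
theorem PushoutI.not_isOfFinOrder_of_mul_of {ι : Type*} {G : ι → Type*} {H : Type*}
    [∀ i, Group (G i)] [Group H] {φ : ∀ i, H →* G i} (hφ : ∀ i, Function.Injective (φ i))
    {i j : ι} (hij : i ≠ j) {g : G i} {h : G j} (hg : g ∉ (φ i).range) (hh : h ∉ (φ j).range) :
    ¬ IsOfFinOrder (PushoutI.of (φ := φ) i g * PushoutI.of j h) := by
  intro hfin
  obtain ⟨n, hn, hpow⟩ := hfin.exists_pow_eq_one
  let L : ℕ → List (Σ i, G i) := fun n => (List.replicate n [⟨i, g⟩, ⟨j, h⟩]).flatten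
  have hL : ∀ n, L (n + 1) = ⟨i, g⟩ :: ⟨j, h⟩ :: L n := fun n => by
    simp [L, List.replicate_succ]
  have hmem : ∀ n, ∀ l ∈ L n, l = ⟨i, g⟩ ∨ l = ⟨j, h⟩ := fun n l hl => by
    simp only [L, List.mem_flatten, List.mem_replicate] at hl
    obtain ⟨_, ⟨-, rfl⟩, hl⟩ := hl
    simpa using hl
  have hred : ∀ n, ∀ l ∈ L n, l.2 ∉ (φ l.1).range := fun n l hl => by
    rcases hmem n l hl with rfl | rfl <;> assumption
  have hchain : ∀ n, (L n).IsChain fun l l' => l.1 ≠ l'.1 := fun n => by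
    induction n with
    | zero => simp [L]
    | succ n ih =>
      rw [hL, List.isChain_cons_cons]
      refine ⟨hij, ?_⟩
      cases n with
      | zero => simp [L]
      | succ n =>
        rw [hL] at ih ⊢
        exact List.isChain_cons_cons.2 ⟨hij.symm, ih⟩
  let w : CoprodI.Word G :=
    ⟨L n, fun l hl h1 => hred n l hl (h1 ▸ one_mem _), hchain n⟩
  have hprod : ∀ n, PushoutI.ofCoprodI (φ := φ)
      ((L n).map fun l => CoprodI.of l.2).prod = (PushoutI.of i g * PushoutI.of j h) ^ n := by
    intro n
    induction n with
    | zero => simp [L]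
    | succ n ih => simp [hL, pow_succ', ih, mul_assoc]
  have hw : w = .empty := PushoutI.Reduced.eq_empty_of_mem_range (w := w) hφ (hred n) <| by
    have : PushoutI.ofCoprodI (φ := φ) w.prod = 1 := (hprod n).trans hpow
    rw [this]
    exact one_mem _
  have hnil : L n = [] := congrArg CoprodI.Word.toList hw
  obtain ⟨k, rfl⟩ := Nat.exists_eq_succ_of_ne_zero hn.ne'
  simp [hL] at hnil

/-- The homomorphism from the group of order two sending its generator to an involution. -/
def involutionHom {G : Type*} [Group G] (x : G) (hx : x * x = 1) :
    Multiplicative (ZMod 2) →* G where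
  toFun h := if h = 1 then 1 else x
  map_one' := if_pos rfl
  map_mul' a b := by
    have key : ∀ a b : Multiplicative (ZMod 2), a ≠ 1 → b ≠ 1 → a * b = 1 := by decide
    by_cases ha : a = 1
    · simp [ha]
    · by_cases hb : b = 1
      · simp [hb]
      · simp [ha, hb, key a b ha hb, hx]

theorem involutionHom_ofAdd_one {G : Type*} [Group G] (x : G) (hx : x * x = 1) :
    involutionHom x hx (Multiplicative.ofAdd 1) = x :=
  if_neg (t := (1 : G)) (show (Multiplicative.ofAdd 1 : Multiplicative (ZMod 2)) ≠ 1 by decide)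

theorem involutionHom_injective {G : Type*} [Group G] {x : G} (hx : x * x = 1) (h1 : x ≠ 1) :
    Function.Injective (involutionHom x hx) := by
  refine (injective_iff_map_eq_one _).2 fun a ha => ?_
  by_contra hne
  exact h1 ((if_neg hne).symm.trans ha)

theorem eq_one_or_eq_of_mem_range_involutionHom {G : Type*} [Group G] {x : G} (hx : x * x = 1)
    {y : G} (hy : y ∈ (involutionHom x hx).range) : y = 1 ∨ y = x := by
  obtain ⟨a, rfl⟩ := hy
  by_cases ha : a = 1
  · exact Or.inl (if_pos ha)
  · exact Or.inr (if_neg ha)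

/-- The cyclic group of order `2 * m` and the dihedral group of order `2 * q`. -/
def CyclicDihedral (m q : ℕ) : Bool → Type
  | true => Multiplicative (ZMod (2 * m))
  | false => DihedralGroup q

instance (m q : ℕ) : ∀ i, Group (CyclicDihedral m q i)
  | true => inferInstanceAs (Group (Multiplicative (ZMod (2 * m))))
  | false => inferInstanceAs (Group (DihedralGroup q))

theorem ofAdd_natCast_mul_self (m : ℕ) :
    (Multiplicative.ofAdd (m : ZMod (2 * m))) * Multiplicative.ofAdd (m : ZMod (2 * m)) = 1 := by
  rw [← ofAdd_add, ← Nat.cast_add, ← two_mul, ZMod.natCast_self, ofAdd_zero]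

/-- The embeddings of the group of order two generated by the element of order two of the cyclic
group and by a reflection of the dihedral group. -/
def CyclicDihedral.emb (m q : ℕ) : ∀ i, Multiplicative (ZMod 2) →* CyclicDihedral m q i
  | true => involutionHom (G := Multiplicative (ZMod (2 * m))) (.ofAdd (m : ZMod (2 * m)))
      (ofAdd_natCast_mul_self m)
  | false => involutionHom (G := DihedralGroup q) (.sr 0) (DihedralGroup.sr_mul_self 0)

theorem CyclicDihedral.emb_injective {m q : ℕ} (hm : 0 < m) (i : Bool) :
    Function.Injective (emb m q i) := by
  cases i with
  | true =>
    refine involutionHom_injective (ofAdd_natCast_mul_self m) fun h => ?_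
    rw [ofAdd_eq_one, ZMod.natCast_eq_zero_iff] at h
    have := Nat.le_of_dvd hm h
    omega
  | false =>
    exact involutionHom_injective (DihedralGroup.sr_mul_self (0 : ZMod q)) fun h => nomatch h

/-- The amalgamated product of the cyclic group of order `2 * m` and the dihedral group of order
`2 * q` over a group of order two. -/
abbrev CyclicDihedral.Amalgam (m q : ℕ) : Type := Monoid.PushoutI (CyclicDihedral.emb m q)

/-- The inclusion of the cyclic group. -/
def CyclicDihedral.ofCyclic (m q : ℕ) : Multiplicative (ZMod (2 * m)) →* Amalgam m q :=
  Monoid.PushoutI.of (φ := emb m q) true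

/-- The inclusion of the dihedral group. -/
def CyclicDihedral.ofDihedral (m q : ℕ) : DihedralGroup q →* Amalgam m q :=
  Monoid.PushoutI.of (φ := emb m q) false

theorem CyclicDihedral.ofCyclic_eq_ofDihedral (m q : ℕ) :
    ofCyclic m q (.ofAdd (m : ZMod (2 * m))) = ofDihedral m q (.sr 0) := by
  have h₁ := Monoid.PushoutI.of_apply_eq_base (emb m q) true (.ofAdd 1)
  have h₂ := Monoid.PushoutI.of_apply_eq_base (emb m q) false (.ofAdd 1)
  exact h₁.trans h₂.symm

theorem CyclicDihedral.lift_presRels (m q : ℕ) :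
    ∀ r ∈ presRels (2 * m) q, FreeGroup.lift
      (fun i : Bool => if i then ofCyclic m q (.ofAdd 1) else ofDihedral m q (.r 1)) r = 1 := by
  rintro r (rfl | rfl | rfl)
  · rw [map_pow, FreeGroup.lift_apply_of, if_pos rfl, ← map_pow, ← ofAdd_nsmul, nsmul_one,
      ZMod.natCast_self, ofAdd_zero, map_one]
  · rw [map_pow, FreeGroup.lift_apply_of, if_neg (by decide), ← map_pow,
      DihedralGroup.r_one_pow_n, map_one]
  · have h : (2 * m) / 2 = m := by omega
    simp only [h, map_pow, map_mul, FreeGroup.lift_apply_of, if_true, Bool.false_eq_true, if_false]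
    rw [← map_pow, ← ofAdd_nsmul, nsmul_one, ofCyclic_eq_ofDihedral, ← map_mul, ← map_pow]
    simp [pow_two]

/-- The comparison map from the presented group to the amalgamated product. -/
def CyclicDihedral.ofPresented (m q : ℕ) : PresentedGroup (presRels (2 * m) q) →* Amalgam m q :=
  PresentedGroup.toGroup (lift_presRels m q)

theorem CyclicDihedral.ofPresented_mul (m q a b : ℕ) :
    ofPresented m q (PresentedGroup.of true ^ a * PresentedGroup.of false ^ b) =
      ofCyclic m q (.ofAdd (a : ZMod (2 * m))) * ofDihedral m q (.r b) := by
  simp only [ofPresented, map_mul, map_pow, PresentedGroup.toGroup.of, if_true, Bool.false_eq_true,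
    if_false]
  rw [← map_pow (ofCyclic m q), ← map_pow (ofDihedral m q), ← ofAdd_nsmul, nsmul_one,
    DihedralGroup.r_one_pow]

theorem mul_pow_sq_eq_one_of_involutions {G : Type*} [Group G] {t y : G} (ht : t ^ 2 = 1)
    (hty : (t * y) ^ 2 = 1) (b : ℕ) : (t * y ^ b) ^ 2 = 1 := by
  have ht' : t⁻¹ = t := by rw [inv_eq_iff_mul_eq_one, ← pow_two, ht]
  have hconj : t * y * t⁻¹ = y⁻¹ := by
    rw [ht', eq_inv_iff_mul_eq_one, mul_assoc, ← pow_two, hty]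
  have hconj' : t * y ^ b * t⁻¹ = (y ^ b)⁻¹ := by rw [← conj_pow, hconj, inv_pow]
  rw [pow_two, ← mul_assoc]
  nth_rw 2 [← ht']
  rw [hconj', inv_mul_cancel]

/-- In the group `G = ⟨α, β ∣ α^p, β^q, (α^{p/2}β)^2⟩` with `p ≥ 4` even and
`q ≥ 3` odd, if an element `α^a β^b` with `0 < a < p`, `0 < b < q` has finite order, then
`a = p/2`, in which case it has order `2`. -/
theorem stmt8 (p q : ℕ) (hp4 : 4 ≤ p) (hpe : Even p) (hq3 : 3 ≤ q) (hqo : Odd q)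
    (a b : ℕ) (ha0 : 0 < a) (hap : a < p) (hb0 : 0 < b) (hbq : b < q)
    (hfin : IsOfFinOrder
      ((PresentedGroup.of true : PresentedGroup (presRels p q)) ^ a *
        PresentedGroup.of false ^ b)) :
    a = p / 2 ∧
      orderOf ((PresentedGroup.of true : PresentedGroup (presRels p q)) ^ a *
        PresentedGroup.of false ^ b) = 2 := by
  obtain ⟨m, rfl⟩ := hpe.two_dvd
  have hm : 0 < m := by omega
  have hhalf : 2 * m / 2 = m := by omega
  have hb : (b : ZMod q) ≠ 0 := fun h => by
    have := Nat.le_of_dvd hb0 ((ZMod.natCast_eq_zero_iff b q).1 h)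
    omega
  have ham : a = m := by
    by_contra ham
    have hfin' := (CyclicDihedral.ofPresented m q).isOfFinOrder hfin
    rw [CyclicDihedral.ofPresented_mul] at hfin'
    refine PushoutI.not_isOfFinOrder_of_mul_of (φ := CyclicDihedral.emb m q)
      (CyclicDihedral.emb_injective hm) (i := true) (j := false) (by decide) ?_ ?_ hfin'
    · intro h
      rcases eq_one_or_eq_of_mem_range_involutionHom (ofAdd_natCast_mul_self m) h
        with h | h
      · have h' := (ZMod.natCast_eq_zero_iff a (2 * m)).1 (Multiplicative.ofAdd.injective h)
        have := Nat.le_of_dvd ha0 h'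
        omega
      · have h' := (ZMod.natCast_eq_natCast_iff' a m (2 * m)).1 (Multiplicative.ofAdd.injective h)
        rw [Nat.mod_eq_of_lt hap, Nat.mod_eq_of_lt (by omega)] at h'
        exact ham h'
    · intro h
      rcases eq_one_or_eq_of_mem_range_involutionHom (DihedralGroup.sr_mul_self (0 : ZMod q)) h
        with h | h
      · exact hb (DihedralGroup.r.inj h)
      · cases h
  subst ham
  refine ⟨hhalf.symm, orderOf_eq_prime ?_ fun h => ?_⟩
  · refine mul_pow_sq_eq_one_of_involutions ?_ ?_ b
    · rw [← pow_mul, mul_comm]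
      exact PresentedGroup.one_of_mem (Or.inl rfl)
    · have h := PresentedGroup.one_of_mem (rels := presRels (2 * a) q) (Or.inr (Or.inr rfl))
      rw [hhalf] at h
      exact h
  · have h' := congrArg (CyclicDihedral.ofPresented a q) h
    rw [CyclicDihedral.ofPresented_mul, CyclicDihedral.ofCyclic_eq_ofDihedral, ← map_mul,
      map_one] at h'
    have h₂ : DihedralGroup.sr (0 : ZMod q) * DihedralGroup.r (b : ZMod q) = 1 :=
      Monoid.PushoutI.of_injective (CyclicDihedral.emb_injective hm) false
        (h'.trans (map_one (CyclicDihedral.ofDihedral a q)).symm)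
    rw [DihedralGroup.sr_mul_r] at h₂
    cases h₂
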